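/- Let k be an integral domain of characteristic zero. Define, for symmetric polynomials f1 ∈ k[h][s_1,…,s_{n1}]^{S_{n1}} and f2 ∈ k[h][s_{n1+1},…,s_n]^{S_{n2}} with n = n1+n2, the twisted product m_τ(f1,f2) = Shuffle( K_{−} · Π_{i ≤ n1 < j} (h + s_i − s_j) · f1 · f2 / Π_{i ≤ n1 < j} (s_i − s_j) ), where K_{−} is any polynomial kernel invariant under S_{n1} × S_{n2}, the factor Π_{i ≤ n1 < j}(h + s_i − s_j) is the twist e(h·g_v[1]), and Shuffle is the sum over (n1,n2)-shuffles. If the untwisted product m (the same formula without the twist factor) is associative, then m_τ is associative. -/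

import Mathlib

open Equiv MvPolynomial

open scoped Classical

variable {k : Type*} [CommRing k] [IsDomain k] [CharZero k]

/-- An `(n1, n2)`-shuffle. -/
def IsShuffle (n1 n2 : ℕ) (σ : Equiv.Perm (Fin (n1 + n2))) : Prop :=
  StrictMono (fun i : Fin n1 => σ (Fin.castAdd n2 i)) ∧
  StrictMono (fun j : Fin n2 => σ (Fin.natAdd n1 j))

/-- The block permutation `τ1 × τ2 ∈ S_{n1} × S_{n2} ⊂ S_{n1+n2}`. -/
def blockPerm {n1 n2 : ℕ} (τ1 : Equiv.Perm (Fin n1)) (τ2 : Equiv.Perm (Fin n2)) :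
    Equiv.Perm (Fin (n1 + n2)) :=
  finSumFinEquiv.symm.trans ((Equiv.sumCongr τ1 τ2).trans finSumFinEquiv)

/-- Polynomials in `s_1, …, s_n` with coefficients in `k[h]`. -/
abbrev PolyH (k : Type*) [CommRing k] (n : ℕ) : Type _ :=
  MvPolynomial (Fin n) (Polynomial k)

/-- Rational functions in `s_1, …, s_n` over `k[h]`. -/
abbrev FracH (k : Type*) [CommRing k] (n : ℕ) : Type _ :=
  FractionRing (PolyH k n)

/-- The field homomorphism between fraction fields induced by an injective renaming
of the variables. -/
noncomputable def fracMap {m n : ℕ} (e : Fin m → Fin n) (he : Function.Injective e) :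
    FracH k m →+* FracH k n :=
  IsFractionRing.lift
    (g := (algebraMap (PolyH k n) (FracH k n)).comp
      (rename e : PolyH k m →ₐ[Polynomial k] PolyH k n).toRingHom)
    (by
      exact (IsFractionRing.injective (PolyH k n) (FracH k n)).comp (rename_injective e he))

/-- The shuffle product on rational functions associated with a family of kernels
`κ n1 n2 ∈ k[h](s_1,…,s_{n1+n2})`:
`F1 * F2 = Σ_σ σ·( κ · F1(s_1,…,s_{n1}) · F2(s_{n1+1},…,s_{n1+n2}) )` over
`(n1,n2)`-shuffles `σ`. -/
noncomputable def shufProd (κ : ∀ n1 n2 : ℕ, FracH k (n1 + n2)) {n1 n2 : ℕ}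
    (F1 : FracH k n1) (F2 : FracH k n2) : FracH k (n1 + n2) :=
  ∑ σ : Equiv.Perm (Fin (n1 + n2)),
    if IsShuffle n1 n2 σ then
      fracMap (⇑σ) σ.injective
        (κ n1 n2 * fracMap (Fin.castAdd n2) (Fin.castAdd_injective n1 n2) F1 *
          fracMap (Fin.natAdd n1)
            (fun a b hab => Fin.ext (Nat.add_left_cancel (congrArg Fin.val hab))) F2)
    else 0

/-- A rational function symmetric in all its variables. -/
def SymmF {n : ℕ} (F : FracH k n) : Prop :=
  ∀ σ : Equiv.Perm (Fin n), fracMap (⇑σ) σ.injective F = F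

/-- Associativity of the shuffle product with kernel family `κ` (on symmetric elements),
up to the canonical identification `(n1+n2)+n3 = n1+(n2+n3)` of variables. -/
def ShufAssoc (κ : ∀ n1 n2 : ℕ, FracH k (n1 + n2)) : Prop :=
  ∀ (n1 n2 n3 : ℕ) (F1 : FracH k n1) (F2 : FracH k n2) (F3 : FracH k n3),
    SymmF F1 → SymmF F2 → SymmF F3 →
    fracMap (⇑(finCongr (Nat.add_assoc n1 n2 n3))) (finCongr (Nat.add_assoc n1 n2 n3)).injective
        (shufProd κ (shufProd κ F1 F2) F3) =
      shufProd κ F1 (shufProd κ F2 F3)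

theorem fracMap_algebraMap {m n : ℕ} (e : Fin m → Fin n) (he : Function.Injective e)
    (p : PolyH k m) :
    fracMap e he (algebraMap (PolyH k m) (FracH k m) p) =
      algebraMap (PolyH k n) (FracH k n) (rename e p) := by
  unfold fracMap
  rw [IsFractionRing.lift_algebraMap]
  rfl

theorem fracMap_fracMap {l m n : ℕ} (e : Fin m → Fin n) (he : Function.Injective e)
    (f : Fin l → Fin m) (hf : Function.Injective f) (x : FracH k l) :
    fracMap e he (fracMap f hf x) = fracMap (e ∘ f) (he.comp hf) x := by
  obtain ⟨a, b, hb, rfl⟩ := IsFractionRing.div_surjective (A := PolyH k l) x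
  simp only [map_div₀, fracMap_algebraMap, rename_rename]

theorem fracMap_congr {m n : ℕ} {e f : Fin m → Fin n} (h : e = f) (he : Function.Injective e)
    (hf : Function.Injective f) (x : FracH k m) : fracMap e he x = fracMap f hf x := by
  subst h; rfl

theorem fracMap_comm {l m m' n : ℕ} (e : Fin m → Fin n) (he : Function.Injective e)
    (f : Fin l → Fin m) (hf : Function.Injective f)
    (e' : Fin m' → Fin n) (he' : Function.Injective e')
    (f' : Fin l → Fin m') (hf' : Function.Injective f')
    (h : ∀ i, e (f i) = e' (f' i)) (x : FracH k l) :
    fracMap e he (fracMap f hf x) = fracMap e' he' (fracMap f' hf' x) := by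
  rw [fracMap_fracMap, fracMap_fracMap]
  exact fracMap_congr (funext h) _ _ x

theorem fracMap_id' {n : ℕ} (e : Fin n → Fin n) (he : Function.Injective e)
    (h : ∀ i, e i = i) (x : FracH k n) : fracMap e he x = x := by
  obtain ⟨a, b, hb, rfl⟩ := IsFractionRing.div_surjective (A := PolyH k n) x
  have : e = id := funext h
  subst this
  simp only [map_div₀, fracMap_algebraMap, rename_id, AlgHom.id_apply]

theorem natAdd_inj (n1 n2 : ℕ) : Function.Injective (Fin.natAdd n1 : Fin n2 → Fin (n1 + n2)) :=
  fun a b hab => Fin.ext (Nat.add_left_cancel (congrArg Fin.val hab))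

theorem blockPerm_castAdd {n1 n2 : ℕ} (τ1 : Equiv.Perm (Fin n1)) (τ2 : Equiv.Perm (Fin n2))
    (i : Fin n1) : blockPerm τ1 τ2 (Fin.castAdd n2 i) = Fin.castAdd n2 (τ1 i) := by
  simp [blockPerm]

theorem blockPerm_natAdd {n1 n2 : ℕ} (τ1 : Equiv.Perm (Fin n1)) (τ2 : Equiv.Perm (Fin n2))
    (i : Fin n2) : blockPerm τ1 τ2 (Fin.natAdd n1 i) = Fin.natAdd n1 (τ2 i) := by
  simp [blockPerm]

theorem perm_ext_add {n1 n2 : ℕ} {σ σ' : Equiv.Perm (Fin (n1 + n2))}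
    (h1 : ∀ i, σ (Fin.castAdd n2 i) = σ' (Fin.castAdd n2 i))
    (h2 : ∀ i, σ (Fin.natAdd n1 i) = σ' (Fin.natAdd n1 i)) : σ = σ' := by
  ext x
  refine Fin.addCases (fun i => ?_) (fun i => ?_) x
  · rw [h1]
  · rw [h2]

/-- Each permutation is uniquely a shuffle times a block permutation. -/
theorem shuffle_bij (n1 n2 : ℕ) :
    Function.Bijective
      (fun p : {σ : Equiv.Perm (Fin (n1 + n2)) // IsShuffle n1 n2 σ} ×
          (Equiv.Perm (Fin n1) × Equiv.Perm (Fin n2)) => p.1.1 * blockPerm p.2.1 p.2.2) := by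
  constructor
  · rintro ⟨⟨σ, hσ⟩, τ1, τ2⟩ ⟨⟨σ', hσ'⟩, τ1', τ2'⟩ h
    simp only at h
    have e1 : ∀ i, σ (Fin.castAdd n2 (τ1 i)) = σ' (Fin.castAdd n2 (τ1' i)) := fun i => by
      have := congrArg (fun π : Equiv.Perm _ => π (Fin.castAdd n2 i)) h
      simpa [blockPerm_castAdd] using this
    have e2 : ∀ i, σ (Fin.natAdd n1 (τ2 i)) = σ' (Fin.natAdd n1 (τ2' i)) := fun i => by
      have := congrArg (fun π : Equiv.Perm _ => π (Fin.natAdd n1 i)) h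
      simpa [blockPerm_natAdd] using this
    have r1 : (fun i : Fin n1 => σ (Fin.castAdd n2 i)) = fun i => σ' (Fin.castAdd n2 i) := by
      refine (StrictMono.range_inj hσ.1 hσ'.1).mp ?_
      have a := τ1.surjective.range_comp (fun i => σ (Fin.castAdd n2 i))
      have b := τ1'.surjective.range_comp (fun i => σ' (Fin.castAdd n2 i))
      rw [← a, ← b]
      exact congrArg Set.range (_root_.funext e1)
    have r2 : (fun i : Fin n2 => σ (Fin.natAdd n1 i)) = fun i => σ' (Fin.natAdd n1 i) := by
      refine (StrictMono.range_inj hσ.2 hσ'.2).mp ?_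
      have a := τ2.surjective.range_comp (fun i => σ (Fin.natAdd n1 i))
      have b := τ2'.surjective.range_comp (fun i => σ' (Fin.natAdd n1 i))
      rw [← a, ← b]
      exact congrArg Set.range (_root_.funext e2)
    have hs : σ = σ' := perm_ext_add (congrFun r1) (congrFun r2)
    subst hs
    have t1 : τ1 = τ1' := Equiv.ext fun i => Fin.castAdd_injective _ _ (σ.injective (e1 i))
    have t2 : τ2 = τ2' := Equiv.ext fun i => natAdd_inj _ _ (σ.injective (e2 i))
    subst t1 t2
    rfl
  · intro π
    let τ1 := Tuple.sort (fun i : Fin n1 => π (Fin.castAdd n2 i))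
    let τ2 := Tuple.sort (fun i : Fin n2 => π (Fin.natAdd n1 i))
    refine ⟨⟨⟨π * blockPerm τ1 τ2, ?_, ?_⟩, τ1⁻¹, τ2⁻¹⟩, ?_⟩
    · have := Tuple.monotone_sort (fun i : Fin n1 => π (Fin.castAdd n2 i))
      have := this.strictMono_of_injective
        ((π.injective.comp (Fin.castAdd_injective _ _)).comp τ1.injective)
      intro a b hab
      simpa [blockPerm_castAdd] using this hab
    · have := Tuple.monotone_sort (fun i : Fin n2 => π (Fin.natAdd n1 i))
      have := this.strictMono_of_injective
        ((π.injective.comp (natAdd_inj _ _)).comp τ2.injective)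
      intro a b hab
      simpa [blockPerm_natAdd] using this hab
    · apply perm_ext_add
      · intro i; simp [blockPerm_castAdd]
      · intro i; simp [blockPerm_natAdd]

/-- Sum over all permutations versus sum over shuffles. -/
theorem sum_shuffle {n1 n2 : ℕ} (G : FracH k (n1 + n2))
    (hG : ∀ τ1 τ2, fracMap (⇑(blockPerm (n1 := n1) (n2 := n2) τ1 τ2)) (Equiv.injective _) G = G) :
    ((n1.factorial * n2.factorial : ℕ) : FracH k (n1 + n2)) *
      (∑ σ : Equiv.Perm (Fin (n1 + n2)),
        if IsShuffle n1 n2 σ then fracMap (⇑σ) σ.injective G else 0) =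
      ∑ σ : Equiv.Perm (Fin (n1 + n2)), fracMap (⇑σ) σ.injective G := by
  rw [← Finset.sum_filter, ← (shuffle_bij n1 n2).sum_comp, Fintype.sum_prod_type]
  have : ∀ (σ : {σ : Equiv.Perm (Fin (n1 + n2)) // IsShuffle n1 n2 σ})
      (τ : Equiv.Perm (Fin n1) × Equiv.Perm (Fin n2)),
      fracMap (⇑(σ.1 * blockPerm τ.1 τ.2)) (Equiv.injective _) G =
        fracMap (⇑σ.1) σ.1.injective G := by
    intro σ τ
    conv_rhs => rw [← hG τ.1 τ.2, fracMap_fracMap]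
    rfl
  simp only [this, Finset.sum_const, Finset.card_univ, Fintype.card_prod, Fintype.card_perm,
    Fintype.card_fin, nsmul_eq_mul]
  rw [← Finset.mul_sum]
  congr 1
  exact Finset.sum_subtype (p := IsShuffle n1 n2)
    (Finset.univ.filter (fun σ => IsShuffle n1 n2 σ)) (by simp)
    (fun σ : Equiv.Perm (Fin (n1 + n2)) => fracMap (⇑σ) σ.injective G)

/-- Block-invariance of a kernel family. -/
def InvK (κ : ∀ n1 n2 : ℕ, FracH k (n1 + n2)) : Prop :=
  ∀ (n1 n2 : ℕ) (τ1 : Equiv.Perm (Fin n1)) (τ2 : Equiv.Perm (Fin n2)),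
    fracMap (⇑(blockPerm τ1 τ2)) (Equiv.injective _) (κ n1 n2) = κ n1 n2

/-- The summand of the shuffle product. -/
noncomputable def term (κ : ∀ n1 n2 : ℕ, FracH k (n1 + n2)) {n1 n2 : ℕ}
    (F1 : FracH k n1) (F2 : FracH k n2) : FracH k (n1 + n2) :=
  κ n1 n2 * fracMap (Fin.castAdd n2) (Fin.castAdd_injective n1 n2) F1 *
          fracMap (Fin.natAdd n1) (natAdd_inj n1 n2) F2

/-- Full symmetrisation. -/
noncomputable def symz {n : ℕ} (G : FracH k n) : FracH k n :=
  ∑ σ : Equiv.Perm (Fin n), fracMap (⇑σ) σ.injective G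

theorem symz_perm {n : ℕ} (G : FracH k n) (ρ : Equiv.Perm (Fin n)) :
    symz (fracMap (⇑ρ) ρ.injective G) = symz G := by
  unfold symz
  rw [← Equiv.sum_comp (Equiv.mulRight ρ) (fun σ => fracMap (⇑σ) σ.injective G)]
  refine Finset.sum_congr rfl fun σ _ => ?_
  rw [fracMap_fracMap]
  rfl

theorem symz_symm {n : ℕ} (G : FracH k n) : SymmF (symz G) := by
  intro ρ
  unfold symz
  rw [map_sum, ← Equiv.sum_comp (Equiv.mulLeft ρ) (fun σ => fracMap (⇑σ) σ.injective G)]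
  refine Finset.sum_congr rfl fun σ _ => ?_
  rw [fracMap_fracMap]
  rfl

theorem symz_sum {n : ℕ} {ι : Type*} (s : Finset ι) (G : ι → FracH k n) :
    symz (∑ i ∈ s, G i) = ∑ i ∈ s, symz (G i) := by
  unfold symz
  simp only [map_sum]
  rw [Finset.sum_comm]

theorem symz_natCast_mul {n : ℕ} (c : ℕ) (G : FracH k n) :
    symz ((c : FracH k n) * G) = c * symz G := by
  unfold symz
  simp only [map_mul, map_natCast, Finset.mul_sum]

theorem symz_sub {n : ℕ} (G H : FracH k n) : symz (G - H) = symz G - symz H := by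
  unfold symz
  simp only [map_sub, Finset.sum_sub_distrib]

theorem symz_cast {m n : ℕ} (h : m = n) (G : FracH k m) :
    fracMap (⇑(finCongr h)) (finCongr h).injective (symz G) =
      symz (fracMap (⇑(finCongr h)) (finCongr h).injective G) := by
  subst h
  rw [fracMap_id' _ _ (fun i => by simp), fracMap_id' _ _ (fun i => by simp)]

theorem term_inv (κ : ∀ n1 n2 : ℕ, FracH k (n1 + n2)) (hκ : InvK κ) {n1 n2 : ℕ}
    (F1 : FracH k n1) (F2 : FracH k n2) (τ1 : Equiv.Perm (Fin n1)) (τ2 : Equiv.Perm (Fin n2)) :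
    fracMap (⇑(blockPerm τ1 τ2)) (Equiv.injective _) (term κ F1 F2) =
      term κ (fracMap (⇑τ1) τ1.injective F1) (fracMap (⇑τ2) τ2.injective F2) := by
  unfold term
  rw [map_mul, map_mul, hκ]
  congr 1
  · congr 1
    exact fracMap_comm _ _ _ _ _ _ _ _ (blockPerm_castAdd τ1 τ2) _
  · exact fracMap_comm _ _ _ _ _ _ _ _ (blockPerm_natAdd τ1 τ2) _

theorem shufProd_symz (κ : ∀ n1 n2 : ℕ, FracH k (n1 + n2)) (hκ : InvK κ) {n1 n2 : ℕ}
    (F1 : FracH k n1) (F2 : FracH k n2) (h1 : SymmF F1) (h2 : SymmF F2) :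
    ((n1.factorial * n2.factorial : ℕ) : FracH k (n1 + n2)) * shufProd κ F1 F2 =
      symz (term κ F1 F2) := by
  refine sum_shuffle (term κ F1 F2) ?_
  intro τ1 τ2
  rw [term_inv κ hκ, h1, h2]

theorem natCast_ne {n c : ℕ} (hc : c ≠ 0) : (c : FracH k n) ≠ 0 := by
  have : CharZero (FracH k n) :=
    charZero_of_injective_algebraMap (IsFractionRing.injective (PolyH k n) (FracH k n))
  exact_mod_cast hc

theorem shufProd_symm (κ : ∀ n1 n2 : ℕ, FracH k (n1 + n2)) (hκ : InvK κ) {n1 n2 : ℕ}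
    (F1 : FracH k n1) (F2 : FracH k n2) (h1 : SymmF F1) (h2 : SymmF F2) :
    SymmF (shufProd κ F1 F2) := by
  intro σ
  have h := shufProd_symz κ hκ F1 F2 h1 h2
  have h' := symz_symm (term κ F1 F2) σ
  rw [← h, map_mul, map_natCast] at h'
  exact mul_left_cancel₀ (natCast_ne (by positivity)) h'

theorem left_symz (κ : ∀ n1 n2 : ℕ, FracH k (n1 + n2)) (hκ : InvK κ) {n1 n2 n3 : ℕ}
    (F1 : FracH k n1) (F2 : FracH k n2) (F3 : FracH k n3)
    (h1 : SymmF F1) (h2 : SymmF F2) (h3 : SymmF F3) :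
    ((n1.factorial * n2.factorial * n3.factorial : ℕ) : FracH k (n1 + n2 + n3)) *
      shufProd κ (shufProd κ F1 F2) F3 = symz (term κ (term κ F1 F2) F3) := by
  have e12 := shufProd_symz κ hκ F1 F2 h1 h2
  have e := shufProd_symz κ hκ (shufProd κ F1 F2) F3 (shufProd_symm κ hκ F1 F2 h1 h2) h3
  have key : ((n1.factorial * n2.factorial : ℕ) : FracH k (n1 + n2 + n3)) *
      term κ (shufProd κ F1 F2) F3 =
      ∑ ρ : Equiv.Perm (Fin (n1 + n2)),
        fracMap (⇑(blockPerm ρ (1 : Equiv.Perm (Fin n3)))) (Equiv.injective _)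
          (term κ (term κ F1 F2) F3) := by
    simp only [term_inv κ hκ]
    have := congrArg (fracMap (Fin.castAdd n3) (Fin.castAdd_injective (n1 + n2) n3)) e12
    rw [map_mul, map_natCast] at this
    have h3' : fracMap (⇑(1 : Equiv.Perm (Fin n3))) (Equiv.injective _) F3 = F3 := h3 1
    simp only [h3']
    unfold term at this ⊢
    rw [← Finset.sum_mul, ← Finset.mul_sum]
    simp only [symz, map_sum] at this
    rw [← this]
    ring
  have key2 := congrArg symz key
  rw [symz_natCast_mul, symz_sum] at key2
  simp only [symz_perm, Finset.sum_const, Finset.card_univ, Fintype.card_perm, Fintype.card_fin,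
    nsmul_eq_mul] at key2
  rw [← e] at key2
  refine mul_left_cancel₀ (natCast_ne (c := (n1 + n2).factorial) (by positivity)) ?_
  rw [← key2]
  push_cast
  ring

theorem right_symz (κ : ∀ n1 n2 : ℕ, FracH k (n1 + n2)) (hκ : InvK κ) {n1 n2 n3 : ℕ}
    (F1 : FracH k n1) (F2 : FracH k n2) (F3 : FracH k n3)
    (h1 : SymmF F1) (h2 : SymmF F2) (h3 : SymmF F3) :
    ((n1.factorial * n2.factorial * n3.factorial : ℕ) : FracH k (n1 + (n2 + n3))) *
      shufProd κ F1 (shufProd κ F2 F3) = symz (term κ F1 (term κ F2 F3)) := by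
  have e12 := shufProd_symz κ hκ F2 F3 h2 h3
  have e := shufProd_symz κ hκ F1 (shufProd κ F2 F3) h1 (shufProd_symm κ hκ F2 F3 h2 h3)
  have key : ((n2.factorial * n3.factorial : ℕ) : FracH k (n1 + (n2 + n3))) *
      term κ F1 (shufProd κ F2 F3) =
      ∑ ρ : Equiv.Perm (Fin (n2 + n3)),
        fracMap (⇑(blockPerm (1 : Equiv.Perm (Fin n1)) ρ)) (Equiv.injective _)
          (term κ F1 (term κ F2 F3)) := by
    simp only [term_inv κ hκ]
    have := congrArg (fracMap (Fin.natAdd n1) (natAdd_inj n1 (n2 + n3))) e12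
    rw [map_mul, map_natCast] at this
    have h1' : fracMap (⇑(1 : Equiv.Perm (Fin n1))) (Equiv.injective _) F1 = F1 := h1 1
    simp only [h1']
    unfold term at this ⊢
    rw [← Finset.mul_sum]
    simp only [symz, map_sum] at this
    rw [← this]
    ring
  have key2 := congrArg symz key
  rw [symz_natCast_mul, symz_sum] at key2
  simp only [symz_perm, Finset.sum_const, Finset.card_univ, Fintype.card_perm, Fintype.card_fin,
    nsmul_eq_mul] at key2
  rw [← e] at key2
  refine mul_left_cancel₀ (natCast_ne (c := (n2 + n3).factorial) (by positivity)) ?_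
  rw [← key2]
  push_cast
  ring

/-- First block embedding. -/
def emb1 (n1 n2 n3 : ℕ) : Fin n1 → Fin (n1 + (n2 + n3)) := Fin.castAdd (n2 + n3)
/-- Second block embedding. -/
def emb2 (n1 n2 n3 : ℕ) : Fin n2 → Fin (n1 + (n2 + n3)) :=
  fun i => Fin.natAdd n1 (Fin.castAdd n3 i)
/-- Third block embedding. -/
def emb3 (n1 n2 n3 : ℕ) : Fin n3 → Fin (n1 + (n2 + n3)) :=
  fun i => Fin.natAdd n1 (Fin.natAdd n2 i)

theorem emb1_inj (n1 n2 n3 : ℕ) : Function.Injective (emb1 n1 n2 n3) :=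
  Fin.castAdd_injective _ _
theorem emb2_inj (n1 n2 n3 : ℕ) : Function.Injective (emb2 n1 n2 n3) :=
  (natAdd_inj _ _).comp (Fin.castAdd_injective _ _)
theorem emb3_inj (n1 n2 n3 : ℕ) : Function.Injective (emb3 n1 n2 n3) :=
  (natAdd_inj _ _).comp (natAdd_inj _ _)

theorem cast_emb1 (n1 n2 n3 : ℕ) (i : Fin n1) :
    finCongr (Nat.add_assoc n1 n2 n3) (Fin.castAdd n3 (Fin.castAdd n2 i)) = emb1 n1 n2 n3 i := by
  ext; simp [emb1]
theorem cast_emb2 (n1 n2 n3 : ℕ) (i : Fin n2) :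
    finCongr (Nat.add_assoc n1 n2 n3) (Fin.castAdd n3 (Fin.natAdd n1 i)) = emb2 n1 n2 n3 i := by
  ext; simp [emb2]
theorem cast_emb3 (n1 n2 n3 : ℕ) (i : Fin n3) :
    finCongr (Nat.add_assoc n1 n2 n3) (Fin.natAdd (n1 + n2) i) = emb3 n1 n2 n3 i := by
  ext; simp [emb3, Nat.add_assoc]

/-- Left iterated kernel. -/
noncomputable def kerL (κ : ∀ n1 n2 : ℕ, FracH k (n1 + n2)) (n1 n2 n3 : ℕ) :
    FracH k (n1 + (n2 + n3)) :=
  fracMap (⇑(finCongr (Nat.add_assoc n1 n2 n3))) (finCongr (Nat.add_assoc n1 n2 n3)).injective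
    (κ (n1 + n2) n3 * fracMap (Fin.castAdd n3) (Fin.castAdd_injective _ _) (κ n1 n2))

/-- Right iterated kernel. -/
noncomputable def kerR (κ : ∀ n1 n2 : ℕ, FracH k (n1 + n2)) (n1 n2 n3 : ℕ) :
    FracH k (n1 + (n2 + n3)) :=
  κ n1 (n2 + n3) * fracMap (Fin.natAdd n1) (natAdd_inj _ _) (κ n2 n3)

/-- The product of three functions in separate variables. -/
noncomputable def tri {n1 n2 n3 : ℕ} (F1 : FracH k n1) (F2 : FracH k n2) (F3 : FracH k n3) :
    FracH k (n1 + (n2 + n3)) :=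
  fracMap (emb1 n1 n2 n3) (emb1_inj _ _ _) F1 * fracMap (emb2 n1 n2 n3) (emb2_inj _ _ _) F2 *
    fracMap (emb3 n1 n2 n3) (emb3_inj _ _ _) F3

theorem term_left (κ : ∀ n1 n2 : ℕ, FracH k (n1 + n2)) {n1 n2 n3 : ℕ}
    (F1 : FracH k n1) (F2 : FracH k n2) (F3 : FracH k n3) :
    fracMap (⇑(finCongr (Nat.add_assoc n1 n2 n3))) (finCongr (Nat.add_assoc n1 n2 n3)).injective
      (term κ (term κ F1 F2) F3) = kerL κ n1 n2 n3 * tri F1 F2 F3 := by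
  unfold term kerL tri
  simp only [map_mul, fracMap_fracMap]
  rw [fracMap_congr (funext (cast_emb3 n1 n2 n3) :
      (finCongr (Nat.add_assoc n1 n2 n3)) ∘ Fin.natAdd (n1 + n2) = _) _ (emb3_inj _ _ _),
    fracMap_congr (funext (cast_emb1 n1 n2 n3) :
      ((finCongr (Nat.add_assoc n1 n2 n3)) ∘ Fin.castAdd n3 ∘ Fin.castAdd n2) = _) _
        (emb1_inj _ _ _),
    fracMap_congr (funext (cast_emb2 n1 n2 n3) :
      ((finCongr (Nat.add_assoc n1 n2 n3)) ∘ Fin.castAdd n3 ∘ Fin.natAdd n1) = _) _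
        (emb2_inj _ _ _)]
  ring

theorem term_right (κ : ∀ n1 n2 : ℕ, FracH k (n1 + n2)) {n1 n2 n3 : ℕ}
    (F1 : FracH k n1) (F2 : FracH k n2) (F3 : FracH k n3) :
    term κ F1 (term κ F2 F3) = kerR κ n1 n2 n3 * tri F1 F2 F3 := by
  unfold term kerR tri
  simp only [map_mul, fracMap_fracMap]
  change _ * fracMap (emb1 n1 n2 n3) (emb1_inj _ _ _) F1 *
    (_ * fracMap (emb2 n1 n2 n3) (emb2_inj _ _ _) F2 *
      fracMap (emb3 n1 n2 n3) (emb3_inj _ _ _) F3) = _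
  ring

/-- Associativity as an identity between full symmetrisations. -/
theorem assoc_iff (κ : ∀ n1 n2 : ℕ, FracH k (n1 + n2)) (hκ : InvK κ) {n1 n2 n3 : ℕ}
    (F1 : FracH k n1) (F2 : FracH k n2) (F3 : FracH k n3)
    (h1 : SymmF F1) (h2 : SymmF F2) (h3 : SymmF F3) :
    (fracMap (⇑(finCongr (Nat.add_assoc n1 n2 n3))) (finCongr (Nat.add_assoc n1 n2 n3)).injective
        (shufProd κ (shufProd κ F1 F2) F3) = shufProd κ F1 (shufProd κ F2 F3)) ↔
    symz (kerL κ n1 n2 n3 * tri F1 F2 F3) = symz (kerR κ n1 n2 n3 * tri F1 F2 F3) := by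
  rw [← term_left, ← term_right, ← symz_cast, ← left_symz κ hκ F1 F2 F3 h1 h2 h3,
    ← right_symz κ hκ F1 F2 F3 h1 h2 h3, map_mul, map_natCast]
  exact (mul_right_injective₀ (natCast_ne (by positivity))).eq_iff.symm

/-- The monoid of symmetric rational functions. -/
def symSub (k : Type*) [CommRing k] [IsDomain k] (n : ℕ) : Submonoid (FracH k n) where
  carrier := {F | SymmF F}
  one_mem' := fun σ => map_one _
  mul_mem' := fun {a b} ha hb σ => by rw [map_mul, ha σ, hb σ]

/-- The character of the monoid of triples given by a permutation. -/
noncomputable def chi {n1 n2 n3 : ℕ} (π : Equiv.Perm (Fin (n1 + (n2 + n3)))) :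
    (symSub k n1 × symSub k n2 × symSub k n3) →* FracH k (n1 + (n2 + n3)) where
  toFun m := fracMap (⇑π) π.injective (tri m.1.1 m.2.1.1 m.2.2.1)
  map_one' := by simp [tri]
  map_mul' a b := by
    simp only [tri, Prod.fst_mul, Prod.snd_mul, Submonoid.coe_mul, map_mul]
    ring

theorem prodX_symm (n : ℕ) :
    SymmF (algebraMap (PolyH k n) (FracH k n) (∏ i : Fin n, X i)) := by
  intro σ
  rw [fracMap_algebraMap]
  rw [map_prod]
  simp only [rename_X]
  congr 1
  exact Equiv.prod_comp σ (fun i => (X i : PolyH k n))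

theorem range_of_prod {m n : ℕ} (e : Fin m → Fin n) (he : Function.Injective e)
    (π : Equiv.Perm (Fin n))
    (h : fracMap (⇑π) π.injective (fracMap e he
        (algebraMap (PolyH k m) (FracH k m) (∏ i : Fin m, X i))) =
      fracMap e he (algebraMap (PolyH k m) (FracH k m) (∏ i : Fin m, X i))) :
    ∃ τ : Equiv.Perm (Fin m), ∀ i, π (e i) = e (τ i) := by
  rw [fracMap_algebraMap, fracMap_algebraMap] at h
  have h' := IsFractionRing.injective (PolyH k n) (FracH k n) h
  simp only [map_prod, rename_X] at h'
  have hex : ∀ i, ∃ j, π (e i) = e j := by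
    intro i
    have hd : (X (π (e i)) : PolyH k n) ∣ ∏ j, X (e j) := by
      rw [← h']
      exact Finset.dvd_prod_of_mem (fun j => (X (π (e j)) : PolyH k n)) (Finset.mem_univ i)
    obtain ⟨j, _, hj⟩ := (MvPolynomial.X_prime (i := π (e i)) (R := Polynomial k)).exists_mem_finset_dvd hd
    exact ⟨j, MvPolynomial.X_dvd_X.mp hj⟩
  choose τ hτ using hex
  have hinj : Function.Injective τ := fun a b hab => by
    apply he
    apply π.injective
    rw [hτ, hτ, hab]
  exact ⟨Equiv.ofBijective τ (Finite.injective_iff_bijective.mp hinj), hτ⟩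

theorem chi_eq {n1 n2 n3 : ℕ} (π : Equiv.Perm (Fin (n1 + (n2 + n3))))
    (h : chi (k := k) π = chi 1) :
    ∃ (τ1 : Equiv.Perm (Fin n1)) (τ2 : Equiv.Perm (Fin n2)) (τ3 : Equiv.Perm (Fin n3)),
      (∀ i, π (emb1 n1 n2 n3 i) = emb1 n1 n2 n3 (τ1 i)) ∧
      (∀ i, π (emb2 n1 n2 n3 i) = emb2 n1 n2 n3 (τ2 i)) ∧
      (∀ i, π (emb3 n1 n2 n3 i) = emb3 n1 n2 n3 (τ3 i)) := by
  have h1 := DFunLike.congr_fun h (⟨_, prodX_symm n1⟩, 1, 1)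
  have h2 := DFunLike.congr_fun h (1, ⟨_, prodX_symm n2⟩, 1)
  have h3 := DFunLike.congr_fun h (1, 1, ⟨_, prodX_symm n3⟩)
  simp only [chi, tri, MonoidHom.coe_mk, OneHom.coe_mk, Submonoid.coe_one, Prod.fst_one,
    Prod.snd_one, map_one, one_mul, mul_one] at h1 h2 h3
  rw [fracMap_id' (⇑(1 : Equiv.Perm (Fin (n1 + (n2 + n3))))) _ (fun i => rfl)] at h1 h2 h3
  obtain ⟨τ1, e1⟩ := range_of_prod _ _ π h1
  obtain ⟨τ2, e2⟩ := range_of_prod _ _ π h2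
  obtain ⟨τ3, e3⟩ := range_of_prod _ _ π h3
  exact ⟨τ1, τ2, τ3, e1, e2, e3⟩

theorem kerL_inv (κ : ∀ n1 n2 : ℕ, FracH k (n1 + n2)) (hκ : InvK κ) {n1 n2 n3 : ℕ}
    (π : Equiv.Perm (Fin (n1 + (n2 + n3))))
    (τ1 : Equiv.Perm (Fin n1)) (τ2 : Equiv.Perm (Fin n2)) (τ3 : Equiv.Perm (Fin n3))
    (e1 : ∀ i, π (emb1 n1 n2 n3 i) = emb1 n1 n2 n3 (τ1 i))
    (e2 : ∀ i, π (emb2 n1 n2 n3 i) = emb2 n1 n2 n3 (τ2 i))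
    (e3 : ∀ i, π (emb3 n1 n2 n3 i) = emb3 n1 n2 n3 (τ3 i)) :
    fracMap (⇑π) π.injective (kerL κ n1 n2 n3) = kerL κ n1 n2 n3 := by
  unfold kerL
  rw [fracMap_comm (⇑π) π.injective _ _ (⇑(finCongr (Nat.add_assoc n1 n2 n3)))
    (finCongr (Nat.add_assoc n1 n2 n3)).injective
    (⇑(blockPerm (blockPerm τ1 τ2) τ3)) (Equiv.injective _), map_mul, hκ,
    fracMap_comm (⇑(blockPerm (blockPerm τ1 τ2) τ3)) (Equiv.injective _) (Fin.castAdd n3)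
      (Fin.castAdd_injective _ _) _ (Fin.castAdd_injective _ _) _ (Equiv.injective _)
      (blockPerm_castAdd _ _), hκ]
  intro x
  refine Fin.addCases (fun y => ?_) (fun i => ?_) x
  · refine Fin.addCases (fun i => ?_) (fun i => ?_) y
    · rw [blockPerm_castAdd, blockPerm_castAdd, cast_emb1, cast_emb1, e1]
    · rw [blockPerm_castAdd, blockPerm_natAdd, cast_emb2, cast_emb2, e2]
  · rw [blockPerm_natAdd, cast_emb3, cast_emb3, e3]

theorem kerR_inv (κ : ∀ n1 n2 : ℕ, FracH k (n1 + n2)) (hκ : InvK κ) {n1 n2 n3 : ℕ}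
    (π : Equiv.Perm (Fin (n1 + (n2 + n3))))
    (τ1 : Equiv.Perm (Fin n1)) (τ2 : Equiv.Perm (Fin n2)) (τ3 : Equiv.Perm (Fin n3))
    (e1 : ∀ i, π (emb1 n1 n2 n3 i) = emb1 n1 n2 n3 (τ1 i))
    (e2 : ∀ i, π (emb2 n1 n2 n3 i) = emb2 n1 n2 n3 (τ2 i))
    (e3 : ∀ i, π (emb3 n1 n2 n3 i) = emb3 n1 n2 n3 (τ3 i)) :
    fracMap (⇑π) π.injective (kerR κ n1 n2 n3) = kerR κ n1 n2 n3 := by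
  have hπ : π = blockPerm τ1 (blockPerm τ2 τ3) := by
    apply perm_ext_add
    · intro i
      rw [blockPerm_castAdd]; exact e1 i
    · intro y
      refine Fin.addCases (fun i => ?_) (fun i => ?_) y
      · rw [blockPerm_natAdd, blockPerm_castAdd]; exact e2 i
      · rw [blockPerm_natAdd, blockPerm_natAdd]; exact e3 i
  subst hπ
  unfold kerR
  rw [map_mul, hκ, fracMap_comm (⇑(blockPerm τ1 (blockPerm τ2 τ3))) (Equiv.injective _)
    (Fin.natAdd n1) (natAdd_inj _ _) _ (natAdd_inj _ _) _ (Equiv.injective _) (blockPerm_natAdd _ _), hκ]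

/-- Associativity forces the cocycle identity, by Dedekind independence of characters. -/
theorem ker_eq (κ : ∀ n1 n2 : ℕ, FracH k (n1 + n2)) (hκ : InvK κ) (ha : ShufAssoc κ)
    (n1 n2 n3 : ℕ) : kerL κ n1 n2 n3 = kerR κ n1 n2 n3 := by
  set D := kerL κ n1 n2 n3 - kerR κ n1 n2 n3 with hD
  have h0 : ∀ m : symSub k n1 × symSub k n2 × symSub k n3,
      ∑ π : Equiv.Perm (Fin (n1 + (n2 + n3))), fracMap (⇑π) π.injective D * chi π m = 0 := by
    intro m
    have := (assoc_iff κ hκ m.1.1 m.2.1.1 m.2.2.1 m.1.2 m.2.1.2 m.2.2.2).mp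
      (ha _ _ _ _ _ _ m.1.2 m.2.1.2 m.2.2.2)
    rw [← sub_eq_zero, ← symz_sub, ← sub_mul, ← hD] at this
    rw [← this]
    unfold symz
    refine Finset.sum_congr rfl fun π _ => ?_
    rw [map_mul]
    rfl
  have hli := linearIndependent_iff'.mp (linearIndependent_monoidHom
    (symSub k n1 × symSub k n2 × symSub k n3) (FracH k (n1 + (n2 + n3))))
    (Finset.univ.image chi)
    (fun f => ∑ π : Equiv.Perm (Fin (n1 + (n2 + n3))) with chi π = f,
      fracMap (⇑π) π.injective D)
    (by
      funext m
      rw [Finset.sum_apply, Pi.zero_apply, ← h0 m,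
        ← Finset.sum_fiberwise_of_maps_to (s := Finset.univ) (t := Finset.univ.image chi)
          (g := chi (k := k)) (fun π _ => Finset.mem_image_of_mem _ (Finset.mem_univ π))]
      refine Finset.sum_congr rfl fun f _ => ?_
      rw [Pi.smul_apply, smul_eq_mul, Finset.sum_mul]
      refine Finset.sum_congr rfl fun π hπ => ?_
      rw [(Finset.mem_filter.mp hπ).2])
    (chi 1) (Finset.mem_image_of_mem _ (Finset.mem_univ 1))
  have hconst : ∀ π ∈ Finset.univ.filter
      (fun π : Equiv.Perm (Fin (n1 + (n2 + n3))) => chi (k := k) π = chi 1),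
      fracMap (⇑π) π.injective D = D := by
    intro π hπ
    obtain ⟨τ1, τ2, τ3, e1, e2, e3⟩ := chi_eq π (Finset.mem_filter.mp hπ).2
    rw [hD, map_sub, kerL_inv κ hκ π τ1 τ2 τ3 e1 e2 e3, kerR_inv κ hκ π τ1 τ2 τ3 e1 e2 e3]
  rw [Finset.sum_congr rfl hconst, Finset.sum_const, nsmul_eq_mul] at hli
  rcases mul_eq_zero.mp hli with h | h
  · exact absurd h (natCast_ne (Finset.card_ne_zero_of_mem
      (Finset.mem_filter.mpr ⟨Finset.mem_univ 1, rfl⟩)))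
  · exact sub_eq_zero.mp h

theorem assoc_of_ker_eq (κ : ∀ n1 n2 : ℕ, FracH k (n1 + n2)) (hκ : InvK κ)
    (h : ∀ n1 n2 n3, kerL κ n1 n2 n3 = kerR κ n1 n2 n3) : ShufAssoc κ := by
  intro n1 n2 n3 F1 F2 F3 h1 h2 h3
  rw [assoc_iff κ hκ F1 F2 F3 h1 h2 h3, h]

/-- A product kernel is block-invariant. -/
theorem rename_prod_block (c : Polynomial k) {n1 n2 : ℕ} (τ1 : Equiv.Perm (Fin n1))
    (τ2 : Equiv.Perm (Fin n2)) :
    rename (⇑(blockPerm τ1 τ2)) (∏ i : Fin n1, ∏ j : Fin n2,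
      (C c + X (Fin.castAdd n2 i) - X (Fin.natAdd n1 j)) : PolyH k (n1 + n2)) =
    ∏ i : Fin n1, ∏ j : Fin n2,
      (C c + X (Fin.castAdd n2 i) - X (Fin.natAdd n1 j)) := by
  simp only [map_prod, map_sub, map_add, rename_X, rename_C, blockPerm_castAdd, blockPerm_natAdd]
  rw [Equiv.prod_comp τ1 (fun i => ∏ j : Fin n2,
    (C c + X (Fin.castAdd n2 i) - X (Fin.natAdd n1 (τ2 j)) : PolyH k (n1 + n2)))]
  refine Finset.prod_congr rfl fun i _ => ?_
  exact Equiv.prod_comp τ2 (fun j =>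
    (C c + X (Fin.castAdd n2 i) - X (Fin.natAdd n1 j) : PolyH k (n1 + n2)))

/-- The twist kernel. -/
noncomputable def twist (k : Type*) [CommRing k] (n1 n2 : ℕ) : FracH k (n1 + n2) :=
  algebraMap (PolyH k (n1 + n2)) (FracH k (n1 + n2))
        (∏ i : Fin n1, ∏ j : Fin n2,
          (C Polynomial.X + X (Fin.castAdd n2 i) - X (Fin.natAdd n1 j)))

theorem twist_ker_eq (n1 n2 n3 : ℕ) :
    kerL (twist k) n1 n2 n3 = kerR (twist k) n1 n2 n3 := by
  unfold kerL kerR twist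
  simp only [fracMap_algebraMap, ← map_mul]
  congr 1
  simp only [map_mul, map_prod, map_sub, map_add, rename_X, rename_C, Fin.prod_univ_add, cast_emb1,
    cast_emb2, cast_emb3, Finset.prod_mul_distrib]
  simp only [emb1, emb2, emb3]
  ring

theorem ker_mul (κ κ' : ∀ n1 n2 : ℕ, FracH k (n1 + n2)) (n1 n2 n3 : ℕ) :
    kerL (fun a b => κ a b * κ' a b) n1 n2 n3 = kerL κ n1 n2 n3 * kerL κ' n1 n2 n3 ∧
    kerR (fun a b => κ a b * κ' a b) n1 n2 n3 = kerR κ n1 n2 n3 * kerR κ' n1 n2 n3 := by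
  unfold kerL kerR
  simp only [map_mul]
  constructor <;> ring


/-- let `K₋ = K n1 n2` be any family of polynomial kernels invariant under
`S_{n1} × S_{n2}`, let `m` be the shuffle product with kernel `K₋ / Π_{i ≤ n1 < j}(s_i − s_j)`
and `m_τ` the twisted product with the extra factor `e(h·g_v[1]) = Π_{i ≤ n1 < j}(h + s_i − s_j)`.
If `m` is associative then `m_τ` is associative. -/
theorem twisted_shuffle_product_assoc
    (K : ∀ n1 n2 : ℕ, PolyH k (n1 + n2))
    (hK : ∀ (n1 n2 : ℕ) (τ1 : Equiv.Perm (Fin n1)) (τ2 : Equiv.Perm (Fin n2)),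
      rename (⇑(blockPerm τ1 τ2)) (K n1 n2) = K n1 n2)
    (hassoc : ShufAssoc (k := k) (fun n1 n2 =>
      algebraMap (PolyH k (n1 + n2)) (FracH k (n1 + n2)) (K n1 n2) /
        algebraMap (PolyH k (n1 + n2)) (FracH k (n1 + n2))
          (∏ i : Fin n1, ∏ j : Fin n2, (X (Fin.castAdd n2 i) - X (Fin.natAdd n1 j))))) :
    ShufAssoc (k := k) (fun n1 n2 =>
      algebraMap (PolyH k (n1 + n2)) (FracH k (n1 + n2)) (K n1 n2) /
        algebraMap (PolyH k (n1 + n2)) (FracH k (n1 + n2))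
          (∏ i : Fin n1, ∏ j : Fin n2, (X (Fin.castAdd n2 i) - X (Fin.natAdd n1 j))) *
      algebraMap (PolyH k (n1 + n2)) (FracH k (n1 + n2))
        (∏ i : Fin n1, ∏ j : Fin n2,
          (C Polynomial.X + X (Fin.castAdd n2 i) - X (Fin.natAdd n1 j)))) := by
  set κ : ∀ n1 n2 : ℕ, FracH k (n1 + n2) := fun n1 n2 =>
      algebraMap (PolyH k (n1 + n2)) (FracH k (n1 + n2)) (K n1 n2) /
        algebraMap (PolyH k (n1 + n2)) (FracH k (n1 + n2))
          (∏ i : Fin n1, ∏ j : Fin n2, (X (Fin.castAdd n2 i) - X (Fin.natAdd n1 j))) with hκdef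
  have hκ : InvK κ := by
    intro n1 n2 τ1 τ2
    have := rename_prod_block (0 : Polynomial k) τ1 τ2
    simp only [map_zero, zero_add] at this
    simp only [hκdef]
    rw [map_div₀, fracMap_algebraMap, fracMap_algebraMap, hK, this]
  have hτ : InvK (fun n1 n2 => κ n1 n2 * twist k n1 n2) := by
    intro n1 n2 τ1 τ2
    simp only
    rw [map_mul, hκ]
    unfold twist
    rw [fracMap_algebraMap, rename_prod_block]
  change ShufAssoc (fun n1 n2 => κ n1 n2 * twist k n1 n2)
  apply assoc_of_ker_eq _ hτ
  intro n1 n2 n3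
  rw [(ker_mul κ (twist k) n1 n2 n3).1, (ker_mul κ (twist k) n1 n2 n3).2,
    ker_eq κ hκ hassoc, twist_ker_eq]
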